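/- There exists a constant C > 0, independent of N, h, ν, T and the data, such that the following holds. Let u₀ : ℝ → ℝ be 1-periodic and continuously differentiable, and let u : [0,T] → (ℤ/Nℤ → ℝ) solve the mass-lumped Galerkin scheme with linear artificial viscosity, with initial nodal values given by the L²-projection: u_h(·,0) = π_h u₀. Then the time derivative satisfies ‖∂_t u_h‖_{L²(Q)} := ( ∫₀^T (h/3)·∑_i ( u_i'(t)² + u_i'(t)·u_{i+1}'(t) + u_{i+1}'(t)² ) dt )^{1/2} ≤ C·( U₀·T^{1/2}·h^{−1/2} + ν^{1/2} )·‖u₀'‖_{L²(0,1)}. -/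

import Mathlib

open Set

/-- The continuous, 1-periodic, piecewise linear function on the uniform mesh
`xᵢ = i/N`, `i ∈ ZMod N`, with nodal values `v`: on the element
`[xᵢ, xᵢ₊₁]` it equals `vᵢ + (x − xᵢ)·(vᵢ₊₁ − vᵢ)/h`, `h = 1/N`. -/
noncomputable def plin (N : ℕ) (v : ZMod N → ℝ) (x : ℝ) : ℝ :=
  v ((⌊x * (N : ℝ)⌋ : ℤ) : ZMod N)
    + (x * (N : ℝ) - (⌊x * (N : ℝ)⌋ : ℤ)) *
        (v (((⌊x * (N : ℝ)⌋ : ℤ) : ZMod N) + 1) - v ((⌊x * (N : ℝ)⌋ : ℤ) : ZMod N))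


lemma mono_aux {T c : ℝ} {f f' : ℝ → ℝ}
    (hd : ∀ t ∈ Icc (0:ℝ) T, HasDerivWithinAt f (f' t) (Icc 0 T) t)
    (hc : ∀ t ∈ Icc (0:ℝ) T, f' t ≤ c) : ∀ t ∈ Icc (0:ℝ) T, f t ≤ f 0 + c * t := by
  intro t ht
  have hT : (0:ℝ) ≤ T := ht.1.trans ht.2
  have hA : AntitoneOn (fun t => f t - c * t) (Icc 0 T) := by
    apply antitoneOn_of_hasDerivWithinAt_nonpos (f' := fun t => f' t - c) (convex_Icc 0 T)
    · exact (fun x hx => (hd x hx).continuousWithinAt.sub (by fun_prop))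
    · intro x hx
      have hx' := interior_subset hx
      have h1 := ((hd x hx').mono interior_subset : HasDerivWithinAt f (f' x) (interior (Icc 0 T)) x)
      have h2 := ((hasDerivAt_id x).const_mul c).hasDerivWithinAt (s := interior (Icc 0 T))
      exact (h1.sub h2).congr_deriv (by simp)
    · intro x hx
      have := hc x (interior_subset hx)
      linarith
  have := hA ⟨le_refl 0, hT⟩ ht ht.1
  simp only at this
  linarith

lemma sum_shift {N : ℕ} [NeZero N] (F : ZMod N → ℝ) : ∑ i, F (i + 1) = ∑ i, F i :=
  Equiv.sum_comp (Equiv.addRight (1 : ZMod N)) F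

lemma sum_shift' {N : ℕ} [NeZero N] (F : ZMod N → ℝ) : ∑ i, F (i - 1) = ∑ i, F i :=
  Equiv.sum_comp (Equiv.subRight (1 : ZMod N)) F

/-- clamp -/
noncomputable def cl (U x : ℝ) : ℝ := max (-U) (min x U)

lemma cl_mul {U : ℝ} (hU : 0 ≤ U) (x y : ℝ) : (x - cl U x) * (cl U y - cl U x) ≤ 0 := by
  have hy1 : -U ≤ cl U y := le_max_left _ _
  have hy2 : cl U y ≤ U := max_le (by linarith) (min_le_right _ _)
  rcases le_total x (-U) with h | h
  · have : cl U x = -U := by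
      unfold cl; rw [min_eq_left (by linarith), max_eq_left h]
    rw [this]; nlinarith
  · rcases le_total x U with h' | h'
    · have : cl U x = x := by
        unfold cl; rw [min_eq_left h', max_eq_right h]
      rw [this]; simp
    · have : cl U x = U := by
        unfold cl; rw [min_eq_right h', max_eq_right (by linarith)]
      rw [this]; nlinarith

lemma cl_abs {U : ℝ} (hU : 0 ≤ U) (x : ℝ) : |cl U x| ≤ U :=
  abs_le.2 ⟨le_max_left _ _, max_le (by linarith) (min_le_right _ _)⟩

lemma cl_eq {U : ℝ} {x : ℝ} (hx : |x| ≤ U) : cl U x = x := by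
  have := abs_le.1 hx
  unfold cl; rw [min_eq_left this.2, max_eq_right this.1]

lemma cl_g_abs {U : ℝ} (hU : 0 ≤ U) (x : ℝ) : |x - cl U x| ≤ |x| := by
  have h := cl_mul hU x 0
  rw [cl_eq (x := 0) (by simpa using hU)] at h
  apply sq_le_sq.1
  nlinarith [sq_nonneg (cl U x)]

lemma cl_hasDeriv {U : ℝ} (hU : 0 ≤ U) (x : ℝ) :
    HasDerivAt (fun x => (x - cl U x) ^ 2) (2 * (x - cl U x)) x := by
  rw [hasDerivAt_iff_isLittleO]
  refine Asymptotics.IsBigO.trans_isLittleO (g := fun y => ‖y - x‖ ^ 2) ?_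
    (Asymptotics.isLittleO_pow_sub_sub x (m := 2) (by norm_num))
  refine Asymptotics.IsBigO.of_bound 1 (Filter.Eventually.of_forall fun y => ?_)
  rw [Real.norm_eq_abs, Real.norm_eq_abs, Real.norm_eq_abs, sq_abs, abs_of_nonneg (sq_nonneg (y - x)), smul_eq_mul, abs_le]
  have h1 := cl_mul hU x y
  have h2 := cl_mul hU y x
  constructor
  · nlinarith [sq_nonneg (y - x), sq_nonneg ((y - cl U y) - (x - cl U x))]
  · nlinarith [sq_nonneg (cl U y - cl U x)]

lemma max_step {a m A M P gx gy x y cx cy : ℝ} (hm : 0 ≤ m) (ham : -m ≤ a) (haA : a + m ≤ A)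
    (hM : |y - x| ≤ 2 * M) (hgx : gx = x - cx) (hgy : gy = y - cy) (hc : gx * (cy - cx) ≤ 0)
    (hy : gy ^ 2 ≤ P) (hmg : m * |gx| ≤ P / 2) (_hM0 : 0 ≤ M) : gx * (a * (y - x)) ≤ (A + M) * P := by
  have hP : 0 ≤ P := (sq_nonneg _).trans hy
  have h1 : gx * (y - x) ≤ P := by
    have : gx * (y - x) = gx * (gy - gx) + gx * (cy - cx) := by rw [hgx, hgy]; ring
    nlinarith [sq_nonneg (gx - gy / 2), sq_nonneg gy]
  have h2 : (a + m) * (gx * (y - x)) ≤ A * P :=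
    (mul_le_mul_of_nonneg_left h1 (by linarith)).trans (mul_le_mul_of_nonneg_right haA hP)
  have h3 : -(m * (gx * (y - x))) ≤ M * P := by
    have e : -(m * (gx * (y - x))) ≤ m * |gx| * |y - x| := by
      rw [mul_assoc, ← abs_mul, ← mul_neg]
      exact mul_le_mul_of_nonneg_left (neg_le_abs _) hm
    have := mul_le_mul hmg hM (abs_nonneg _) (by linarith)
    linarith
  linarith

lemma max_principle {N : ℕ} [NeZero N] {T h U κ : ℝ} (hh : 0 < h) (hU : 0 ≤ U) (hκ : U / 2 ≤ κ)
    {u u' : ℝ → ZMod N → ℝ}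
    (hd : ∀ i, ∀ t ∈ Icc (0 : ℝ) T,
        HasDerivWithinAt (fun s => u s i) (u' t i) (Icc (0 : ℝ) T) t)
    (hs : ∀ i, ∀ t ∈ Icc (0 : ℝ) T,
        h * u' t i = (κ - (u t (i-1) + u t i + u t (i+1)) / 6) * (u t (i+1) - u t i)
          + (κ + (u t (i-1) + u t i + u t (i+1)) / 6) * (u t (i-1) - u t i))
    (h0 : ∀ i, |u 0 i| ≤ U) : ∀ t ∈ Icc (0:ℝ) T, ∀ i, |u t i| ≤ U := by
  obtain ⟨M, hM⟩ : ∃ M, ∀ t ∈ Icc (0:ℝ) T, ‖u t‖ ≤ M := by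
    apply isCompact_Icc.exists_bound_of_continuousOn
    exact continuousOn_pi.2 fun i t ht => (hd i t ht).continuousWithinAt
  have hM' : ∀ t ∈ Icc (0:ℝ) T, ∀ i, |u t i| ≤ M := fun t ht i =>
    (norm_le_pi_norm (u t) i).trans (hM t ht)
  set Ψ : ℝ → ℝ := fun t => ∑ i, (u t i - cl U (u t i)) ^ 2 with hΨ
  have hΨd : ∀ t ∈ Icc (0:ℝ) T,
      HasDerivWithinAt Ψ (∑ i, 2 * (u t i - cl U (u t i)) * u' t i) (Icc 0 T) t := by
    intro t ht
    apply HasDerivWithinAt.fun_sum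
    intro i _
    exact (cl_hasDeriv hU (u t i)).comp_hasDerivWithinAt t (hd i t ht)
  set K : ℝ := N * (2 / h * (2 * (κ + M + M))) with hK
  have key : ∀ t ∈ Icc (0:ℝ) T, (∑ i, 2 * (u t i - cl U (u t i)) * u' t i) ≤ K * Ψ t := by
    intro t ht
    have hM0 : 0 ≤ M := (abs_nonneg _).trans (hM' t ht 0)
    have hle : ∀ i, (u t i - cl U (u t i)) ^ 2 ≤ Ψ t := fun i =>
      Finset.single_le_sum (f := fun i => (u t i - cl U (u t i)) ^ 2)
        (fun _ _ => sq_nonneg _) (Finset.mem_univ i)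
    have hΨ0 : 0 ≤ Ψ t := (sq_nonneg _).trans (hle 0)
    set r := Real.sqrt (Ψ t) with hr
    have hrr : r * r = Ψ t := Real.mul_self_sqrt hΨ0
    have hr0 : 0 ≤ r := Real.sqrt_nonneg _
    have hgr : ∀ i, |u t i - cl U (u t i)| ≤ r := fun i => Real.abs_le_sqrt (hle i)
    have hgM : ∀ i, |u t i - cl U (u t i)| ≤ M := fun i => (cl_g_abs hU _).trans (hM' t ht i)
    have hug : ∀ i, |u t i| ≤ U + |u t i - cl U (u t i)| := by
      intro i
      have h1 := abs_add_le (cl U (u t i)) (u t i - cl U (u t i))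
      rw [add_sub_cancel] at h1
      linarith [cl_abs hU (u t i)]
    have term : ∀ i, 2 * (u t i - cl U (u t i)) * u' t i
        ≤ (2 / h * (2 * (κ + M + M))) * Ψ t := by
      intro i
      have e1 := abs_le.1 (hug (i-1))
      have e2 := abs_le.1 (hug i)
      have e3 := abs_le.1 (hug (i+1))
      have f1 := abs_le.1 (hM' t ht (i-1))
      have f2 := abs_le.1 (hM' t ht i)
      have f3 := abs_le.1 (hM' t ht (i+1))
      set m := (|u t (i-1) - cl U (u t (i-1))| + |u t i - cl U (u t i)|
        + |u t (i+1) - cl U (u t (i+1))|) / 6 with hm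
      have hm0 : 0 ≤ m := by positivity
      have hmr : m ≤ r / 2 := by linarith [hgr (i-1), hgr i, hgr (i+1)]
      have hmM : m ≤ M / 2 := by linarith [hgM (i-1), hgM i, hgM (i+1)]
      have hmg : m * |u t i - cl U (u t i)| ≤ Ψ t / 2 := by
        have := mul_le_mul hmr (hgr i) (abs_nonneg _) (by positivity)
        linarith
      have s1 := max_step (a := κ - (u t (i-1) + u t i + u t (i+1)) / 6) (A := κ + M) (M := M)
        (x := u t i) (y := u t (i+1)) hm0
        (by linarith) (by linarith)
        (by rw [abs_le]; constructor <;> linarith) rfl rfl (cl_mul hU _ _) (hle (i+1)) hmg hM0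
      have s2 := max_step (a := κ + (u t (i-1) + u t i + u t (i+1)) / 6) (A := κ + M) (M := M)
        (x := u t i) (y := u t (i-1)) hm0
        (by linarith) (by linarith)
        (by rw [abs_le]; constructor <;> linarith) rfl rfl (cl_mul hU _ _) (hle (i-1)) hmg hM0
      have s3 : (u t i - cl U (u t i)) * (h * u' t i) ≤ 2 * (κ + M + M) * Ψ t := by
        rw [hs i t ht]; linarith
      calc 2 * (u t i - cl U (u t i)) * u' t i
          = 2 / h * ((u t i - cl U (u t i)) * (h * u' t i)) := by field_simp
        _ ≤ 2 / h * (2 * (κ + M + M) * Ψ t) := mul_le_mul_of_nonneg_left s3 (by positivity)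
        _ = _ := by ring
    calc _ ≤ ∑ i : ZMod N, (2 / h * (2 * (κ + M + M))) * Ψ t := Finset.sum_le_sum fun i _ => term i
      _ = K * Ψ t := by
        simp [Finset.sum_const, ZMod.card, hK]; ring
  have hΨ00 : Ψ 0 = 0 := by
    simp only [hΨ]
    exact Finset.sum_eq_zero fun i _ => by rw [cl_eq (h0 i)]; simp
  intro t ht i
  have hF : ∀ t ∈ Icc (0:ℝ) T, HasDerivWithinAt (fun t => Real.exp (-K * t) * Ψ t)
      ((Real.exp (-K * t) * (-K)) * Ψ t
        + Real.exp (-K * t) * (∑ i, 2 * (u t i - cl U (u t i)) * u' t i)) (Icc 0 T) t := by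
    intro t ht
    have := ((hasDerivAt_id t).const_mul (-K)).exp.hasDerivWithinAt (s := Icc 0 T)
    simp only [mul_one, id] at this
    exact this.mul (hΨd t ht)
  have := mono_aux (c := 0) hF (fun t ht => by
    have := mul_le_mul_of_nonneg_left (key t ht) (Real.exp_pos (-K * t)).le
    nlinarith) t ht
  simp only [hΨ00] at this
  have hΨt : Ψ t ≤ 0 := by
    have hp := Real.exp_pos (-K * t)
    by_contra hcon
    push Not at hcon
    have := mul_pos hp hcon
    linarith
  have hz : (u t i - cl U (u t i)) ^ 2 ≤ 0 :=
    (Finset.single_le_sum (f := fun i => (u t i - cl U (u t i)) ^ 2)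
        (fun _ _ => sq_nonneg _) (Finset.mem_univ i)).trans hΨt
  have hz' : u t i - cl U (u t i) = 0 := by
    have := le_antisymm hz (sq_nonneg _)
    exact pow_eq_zero_iff (two_ne_zero) |>.1 this
  rw [sub_eq_zero.1 hz']; exact cl_abs hU _

lemma tvd {N : ℕ} [NeZero N] {T h U κ : ℝ} (hh : 0 < h) (hκ : U / 2 ≤ κ)
    {u u' : ℝ → ZMod N → ℝ}
    (hd : ∀ i, ∀ t ∈ Icc (0 : ℝ) T,
        HasDerivWithinAt (fun s => u s i) (u' t i) (Icc (0 : ℝ) T) t)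
    (hs : ∀ i, ∀ t ∈ Icc (0 : ℝ) T,
        h * u' t i = (κ - (u t (i-1) + u t i + u t (i+1)) / 6) * (u t (i+1) - u t i)
          + (κ + (u t (i-1) + u t i + u t (i+1)) / 6) * (u t (i-1) - u t i))
    (hb : ∀ t ∈ Icc (0:ℝ) T, ∀ i, |u t i| ≤ U) :
    ∀ t ∈ Icc (0:ℝ) T, ∑ i, |u t (i+1) - u t i| ≤ ∑ i, |u 0 (i+1) - u 0 i| := by
  have main : ∀ ε : ℝ, 0 < ε → ∀ t ∈ Icc (0:ℝ) T,
      ∑ i, |u t (i+1) - u t i| ≤ ∑ i, |u 0 (i+1) - u 0 i| + (N + N * (2 * κ) / h * t) * ε := by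
    intro ε hε
    have hpos : ∀ x : ℝ, 0 < x ^ 2 + ε ^ 2 := fun x => by positivity
    have hder : ∀ t ∈ Icc (0:ℝ) T, HasDerivWithinAt
        (fun s => ∑ i, Real.sqrt ((u s (i+1) - u s i) ^ 2 + ε ^ 2))
        (∑ i, (u t (i+1) - u t i) / Real.sqrt ((u t (i+1) - u t i) ^ 2 + ε ^ 2)
          * (u' t (i+1) - u' t i)) (Icc 0 T) t := by
      intro t ht
      apply HasDerivWithinAt.fun_sum
      intro i _
      have h1 := ((((hd (i+1) t ht).sub (hd i t ht)).pow 2).add_const (ε ^ 2)).sqrt (hpos _).ne'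
      refine h1.congr_deriv ?_
      have := (Real.sqrt_pos.2 (hpos (u t (i+1) - u t i))).ne'
      simp
      field_simp
    have hle : ∀ t ∈ Icc (0:ℝ) T,
        (∑ i, (u t (i+1) - u t i) / Real.sqrt ((u t (i+1) - u t i) ^ 2 + ε ^ 2)
          * (u' t (i+1) - u' t i)) ≤ N * (2 * κ) / h * ε := by
      intro t ht
      set D : ZMod N → ℝ := fun i => u t (i+1) - u t i with hD
      set φ : ZMod N → ℝ := fun i => D i / Real.sqrt (D i ^ 2 + ε ^ 2) with hφ
      set a : ZMod N → ℝ := fun i => κ - (u t (i-1) + u t i + u t (i+1)) / 6 with ha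
      set b : ZMod N → ℝ := fun i => κ + (u t (i-1) + u t i + u t (i+1)) / 6 with hb'
      have ha0 : ∀ i, 0 ≤ a i := fun i => by
        have e1 := abs_le.1 (hb t ht (i-1))
        have e2 := abs_le.1 (hb t ht i)
        have e3 := abs_le.1 (hb t ht (i+1))
        simp only [ha]; linarith
      have hb0 : ∀ i, 0 ≤ b i := fun i => by
        have e1 := abs_le.1 (hb t ht (i-1))
        have e2 := abs_le.1 (hb t ht i)
        have e3 := abs_le.1 (hb t ht (i+1))
        simp only [hb']; linarith
      have hφ1 : ∀ i, |φ i| ≤ 1 := fun i => by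
        have := Real.sqrt_pos.2 (hpos (D i))
        simp only [hφ]
        rw [abs_div, abs_of_pos this, div_le_one this]
        exact Real.abs_le_sqrt (by nlinarith [sq_nonneg ε])
      have hφ2 : ∀ i, |D i| - ε ≤ φ i * D i := fun i => by
        have hq := Real.sqrt_pos.2 (hpos (D i))
        have hsq := Real.sq_sqrt (hpos (D i)).le
        simp only [hφ]
        rw [div_mul_eq_mul_div, le_div_iff₀ hq]
        have h2 : Real.sqrt (D i ^ 2 + ε ^ 2) ≤ |D i| + ε := by
          apply Real.sqrt_le_iff.2 ⟨by positivity, ?_⟩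
          nlinarith [sq_abs (D i), abs_nonneg (D i)]
        have h3 : |D i| ≤ Real.sqrt (D i ^ 2 + ε ^ 2) := Real.abs_le_sqrt (by nlinarith [sq_nonneg ε])
        rcases le_total (|D i|) ε with h4 | h4
        · nlinarith [sq_nonneg (D i)]
        · nlinarith [sq_abs (D i)]
      have hφD : ∀ i j, φ i * D j ≤ |D j| := fun i j => by
        calc φ i * D j ≤ |φ i * D j| := le_abs_self _
          _ = |φ i| * |D j| := abs_mul _ _
          _ ≤ 1 * |D j| := mul_le_mul_of_nonneg_right (hφ1 i) (abs_nonneg _)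
          _ = _ := one_mul _
      have hterm : ∀ i, φ i * (h * u' t (i+1) - h * u' t i) ≤
          (a (i+1) * |D (i+1)| - a i * |D i|) + (b i * |D (i-1)| - b (i+1) * |D i|)
            + (b (i+1) + a i) * ε := by
        intro i
        rw [hs (i+1) t ht, hs i t ht]
        have h1 := mul_le_mul_of_nonneg_left (hφD i (i+1)) (ha0 (i+1))
        have h2 := mul_le_mul_of_nonneg_left (hφD i (i-1)) (hb0 i)
        have h3 := mul_le_mul_of_nonneg_left (hφ2 i) (add_nonneg (hb0 (i+1)) (ha0 i))
        have e : φ i * ((κ - (u t (i+1-1) + u t (i+1) + u t (i+1+1)) / 6) * (u t (i+1+1) - u t (i+1))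
          + (κ + (u t (i+1-1) + u t (i+1) + u t (i+1+1)) / 6) * (u t (i+1-1) - u t (i+1))
          - ((κ - (u t (i-1) + u t i + u t (i+1)) / 6) * (u t (i+1) - u t i)
          + (κ + (u t (i-1) + u t i + u t (i+1)) / 6) * (u t (i-1) - u t i)))
          = a (i+1) * (φ i * D (i+1)) + b i * (φ i * D (i-1)) - (b (i+1) + a i) * (φ i * D i) := by
          simp only [ha, hb', hD, add_sub_cancel_right, sub_add_cancel]
          ring
        rw [e]; linarith
      have hsum := Finset.sum_le_sum fun i (_ : i ∈ (Finset.univ : Finset (ZMod N))) => hterm i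
      have q1 : ∑ i, (a (i+1) * |D (i+1)| - a i * |D i|) = 0 := by
        rw [Finset.sum_sub_distrib, sum_shift (fun i => a i * |D i|), sub_self]
      have q2 : ∑ i, (b i * |D (i-1)| - b (i+1) * |D i|) = 0 := by
        rw [Finset.sum_sub_distrib, ← sum_shift (fun i => b i * |D (i-1)|)]
        simp
      have q3 : ∑ i, (b (i+1) + a i) * ε = N * (2 * κ) * ε := by
        rw [← Finset.sum_mul, Finset.sum_add_distrib, sum_shift b, ← Finset.sum_add_distrib]
        congr 1
        have : ∀ i, b i + a i = 2 * κ := fun i => by simp only [ha, hb']; ring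
        simp [this, ZMod.card]
      rw [Finset.sum_add_distrib, Finset.sum_add_distrib, q1, q2, q3] at hsum
      have : ∑ i, φ i * (u' t (i+1) - u' t i) = (∑ i, φ i * (h * u' t (i+1) - h * u' t i)) / h := by
        rw [Finset.sum_div]
        refine Finset.sum_congr rfl fun i _ => ?_
        field_simp
      rw [this, div_le_iff₀ hh]
      calc _ ≤ _ := hsum
        _ = _ := by field_simp; ring
    intro t ht
    have h1 := mono_aux hder hle t ht
    have h2 : ∑ i, |u t (i+1) - u t i| ≤ ∑ i, Real.sqrt ((u t (i+1) - u t i) ^ 2 + ε ^ 2) :=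
      Finset.sum_le_sum fun i _ => Real.abs_le_sqrt (by nlinarith [sq_nonneg ε])
    have h3 : ∑ i, Real.sqrt ((u 0 (i+1) - u 0 i) ^ 2 + ε ^ 2) ≤ ∑ i, |u 0 (i+1) - u 0 i| + N * ε := by
      calc _ ≤ ∑ i : ZMod N, (|u 0 (i+1) - u 0 i| + ε) := Finset.sum_le_sum fun i _ => by
            apply Real.sqrt_le_iff.2 ⟨by positivity, ?_⟩
            nlinarith [sq_abs (u 0 (i+1) - u 0 i), abs_nonneg (u 0 (i+1) - u 0 i)]
        _ = _ := by rw [Finset.sum_add_distrib]; simp [ZMod.card]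
    linarith
  intro t ht
  refine le_of_forall_pos_le_add fun δ hδ => ?_
  set B := (N + N * (2 * κ) / h * t : ℝ) with hB
  have := main (δ / (|B| + 1)) (by positivity) t ht
  refine this.trans (add_le_add_right ?_ _)
  rw [mul_div_assoc', div_le_iff₀ (by positivity)]
  nlinarith [le_abs_self B]

lemma plin_elem {N : ℕ} (hN : 0 < N) (v : ZMod N → ℝ) (k : ℕ) {x : ℝ}
    (hx : x ∈ Icc ((k:ℝ) / N) (((k + 1 : ℕ) : ℝ) / N)) :
    plin N v x = v (k : ZMod N) + (x * N - k) * (v ((k : ZMod N) + 1) - v (k : ZMod N)) := by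
  have hN' : (0:ℝ) < N := by exact_mod_cast hN
  have h1 : (k:ℝ) ≤ x * N := (div_le_iff₀ hN').1 hx.1
  have h2 : x * N ≤ k + 1 := by have := (le_div_iff₀ hN').1 hx.2; push_cast at this; exact this
  rcases h2.lt_or_eq with h | h
  · have hf : ⌊x * (N:ℝ)⌋ = (k : ℤ) := by
      rw [Int.floor_eq_iff]; push_cast; exact ⟨h1, h⟩
    unfold plin; rw [hf]; push_cast; rfl
  · have hf : ⌊x * (N:ℝ)⌋ = ((k : ℤ) + 1) := by
      rw [Int.floor_eq_iff]; push_cast; constructor <;> linarith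
    unfold plin; rw [hf, h]; push_cast; ring

lemma sum_zmod {N : ℕ} [NeZero N] (F : ZMod N → ℝ) :
    ∑ i, F i = ∑ k ∈ Finset.range N, F (k : ZMod N) := by
  symm
  refine Finset.sum_bij (fun k _ => (k : ZMod N)) (fun _ _ => Finset.mem_univ _) ?_ ?_ ?_
  · intro a ha b hb hab
    have := congrArg ZMod.val hab
    rwa [ZMod.val_natCast_of_lt (Finset.mem_range.1 ha),
      ZMod.val_natCast_of_lt (Finset.mem_range.1 hb)] at this
  · intro b _
    exact ⟨b.val, Finset.mem_range.2 (ZMod.val_lt b), ZMod.natCast_zmod_val b⟩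
  · intros; rfl

lemma integral_elems {N : ℕ} (hN : 0 < N) (f : ℝ → ℝ) (g : ℕ → ℝ → ℝ)
    (hg : ∀ k, Continuous (g k))
    (hfg : ∀ k : ℕ, ∀ x ∈ Icc ((k:ℝ) / N) (((k + 1 : ℕ) : ℝ) / N), f x = g k x) :
    ∫ x in (0:ℝ)..1, f x
      = ∑ k ∈ Finset.range N, ∫ x in ((k:ℝ) / N)..(((k + 1 : ℕ) : ℝ) / N), g k x := by
  have hN' : (0:ℝ) < N := by exact_mod_cast hN
  have hle : ∀ k : ℕ, (k:ℝ) / N ≤ ((k + 1 : ℕ) : ℝ) / N := fun k => by gcongr; simp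
  have hE : ∀ k : ℕ, EqOn (g k) f (uIcc ((k:ℝ) / N) (((k + 1 : ℕ) : ℝ) / N)) := fun k x hx => by
    rw [uIcc_of_le (hle k)] at hx; exact (hfg k x hx).symm
  have := intervalIntegral.sum_integral_adjacent_intervals (f := f) (μ := MeasureTheory.volume)
    (a := fun k : ℕ => (k:ℝ) / N) (n := N) (fun k _ =>
      ((hg k).continuousOn.congr (hE k).symm).intervalIntegrable)
  simp only [Nat.cast_zero, zero_div, div_self hN'.ne'] at this
  rw [← this]
  exact Finset.sum_congr rfl fun k _ => intervalIntegral.integral_congr (hE k).symm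

lemma cs_aux {f : ℝ → ℝ} (hf : ContDiff ℝ 1 f) {x y : ℝ} (hxy : x ≤ y) :
    (f y - f x) ^ 2 ≤ (y - x) * ∫ s in x..y, deriv f s ^ 2 := by
  have hc : Continuous (deriv f) := hf.continuous_deriv (le_refl _)
  have hI : ∫ s in x..y, deriv f s = f y - f x :=
    intervalIntegral.integral_deriv_eq_sub (fun s _ => (hf.differentiable one_ne_zero) s)
      (hc.intervalIntegrable _ _)
  have h0 : 0 ≤ ∫ s in x..y, ((y - x) * deriv f s - (f y - f x)) ^ 2 :=
    intervalIntegral.integral_nonneg hxy fun _ _ => sq_nonneg _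
  have e : ∫ s in x..y, ((y - x) * deriv f s - (f y - f x)) ^ 2
      = (y - x) ^ 2 * (∫ s in x..y, deriv f s ^ 2) - 2 * (y - x) * (f y - f x) * (f y - f x)
        + (y - x) * (f y - f x) ^ 2 := by
    have : ∀ s, ((y - x) * deriv f s - (f y - f x)) ^ 2
      = (y - x) ^ 2 * deriv f s ^ 2 - 2 * (y - x) * (f y - f x) * deriv f s
        + (f y - f x) ^ 2 := fun s => by ring
    simp_rw [this]
    rw [intervalIntegral.integral_add, intervalIntegral.integral_sub,
      intervalIntegral.integral_const_mul, intervalIntegral.integral_const_mul, hI,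
      intervalIntegral.integral_const, smul_eq_mul]
    all_goals exact Continuous.intervalIntegrable (by fun_prop) _ _
  rw [e] at h0
  rcases hxy.eq_or_lt with rfl | h
  · simp
  · have hp : 0 < y - x := sub_pos.2 h
    have : 0 ≤ (y - x) * ((y - x) * (∫ s in x..y, deriv f s ^ 2) - (f y - f x) ^ 2) := by
      nlinarith
    have := nonneg_of_mul_nonneg_right this hp
    linarith

lemma cs_elem {f : ℝ → ℝ} (hf : ContDiff ℝ 1 f) {a b x y : ℝ} (hax : a ≤ x) (hxy : x ≤ y)
    (hyb : y ≤ b) : (f y - f x) ^ 2 ≤ (b - a) * ∫ s in a..b, deriv f s ^ 2 := by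
  have hc : Continuous (deriv f) := hf.continuous_deriv (le_refl _)
  refine (cs_aux hf hxy).trans ?_
  apply mul_le_mul (by linarith) _ (intervalIntegral.integral_nonneg hxy fun _ _ => sq_nonneg _)
    (by linarith)
  exact intervalIntegral.integral_mono_interval hax hxy hyb
    (Filter.Eventually.of_forall fun _ => sq_nonneg _)
    (Continuous.intervalIntegrable (by fun_prop) _ _)

lemma proj_stab {N : ℕ} [NeZero N] {u₀ : ℝ → ℝ} (hu : ContDiff ℝ 1 u₀)
    (hper : ∀ x, u₀ (x + 1) = u₀ x) (w : ZMod N → ℝ)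
    (hw : ∀ v : ZMod N → ℝ, (∫ x in (0 : ℝ)..1, (u₀ x - plin N w x) * plin N v x) = 0) :
    ∑ i, (w (i + 1) - w i) ^ 2 ≤ 26 / N * ∫ x in (0:ℝ)..1, deriv u₀ x ^ 2 := by
  have hN : 0 < N := Nat.pos_of_ne_zero (NeZero.ne N)
  have hN' : (0:ℝ) < N := by exact_mod_cast hN
  have hc : Continuous (deriv u₀) := hu.continuous_deriv (le_refl _)
  have hc0 : Continuous u₀ := hu.continuous
  set v : ZMod N → ℝ := fun i => u₀ ((i.val : ℝ) / N) with hv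
  have hv1 : ∀ k < N, v (k : ZMod N) = u₀ ((k:ℝ) / N) := fun k hk => by
    simp only [hv]; rw [ZMod.val_natCast_of_lt hk]
  have hv2 : ∀ k < N, v ((k : ZMod N) + 1) = u₀ (((k + 1 : ℕ):ℝ) / N) := fun k hk => by
    rcases Nat.lt_or_ge (k+1) N with h | h
    · rw [← hv1 _ h]; push_cast; rfl
    · have hkN : k + 1 = N := by omega
      have : ((k : ZMod N) + 1) = ((0 : ℕ) : ZMod N) := by
        rw [← Nat.cast_succ, Nat.succ_eq_add_one, hkN]; simp
      rw [this, hv1 0 hN, hkN, div_self hN'.ne']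
      have := hper 0
      simp at this ⊢; exact this.symm
  set e : ZMod N → ℝ := fun i => w i - v i with he
  set L : (ZMod N → ℝ) → ℕ → ℝ → ℝ := fun q k x =>
    q (k : ZMod N) + (x * N - k) * (q ((k : ZMod N) + 1) - q (k : ZMod N)) with hL
  have hLc : ∀ q k, Continuous (L q k) := fun q k => by simp only [hL]; fun_prop
  have hle : ∀ k : ℕ, (k:ℝ) / N ≤ ((k + 1 : ℕ) : ℝ) / N := fun k => by gcongr; simp
  have hwid : ∀ k : ℕ, ((k + 1 : ℕ) : ℝ) / N - (k:ℝ) / N = 1 / N := fun k => by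
    push_cast; ring
  have horth := hw e
  rw [integral_elems hN _ (fun k x => (u₀ x - L w k x) * L e k x)
    (fun k => by have := hLc w k; have := hLc e k; fun_prop)
    (fun k x hx => by rw [plin_elem hN w k hx, plin_elem hN e k hx])] at horth
  have hEint := integral_elems hN (fun x => deriv u₀ x ^ 2) (fun _ x => deriv u₀ x ^ 2)
    (fun _ => by fun_prop) (fun _ _ _ => rfl)
  set J : ℕ → ℝ := fun k => ∫ x in ((k:ℝ) / N)..(((k + 1 : ℕ) : ℝ) / N), deriv u₀ x ^ 2 with hJ
  -- orthogonality estimate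
  have hr : ∀ k < N, ∀ x ∈ Icc ((k:ℝ) / N) (((k + 1 : ℕ) : ℝ) / N),
      (u₀ x - L v k x) ^ 2 ≤ 1 / N * J k := by
    intro k hk x hx
    have h1 := cs_elem hu (le_refl _) hx.1 hx.2
    have h2 := cs_elem hu hx.1 hx.2 (le_refl _)
    rw [hwid] at h1 h2
    have s0 : 0 ≤ x * N - k := by have := (div_le_iff₀ hN').1 hx.1; linarith
    have s1 : x * N - k ≤ 1 := by
      have := (le_div_iff₀ hN').1 hx.2; push_cast at this; linarith
    simp only [hL]
    rw [hv1 k hk, hv2 k hk]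
    set s := x * N - k
    set A := u₀ x - u₀ ((k:ℝ) / N)
    set B := u₀ (((k + 1 : ℕ):ℝ) / N) - u₀ x
    have e1 : u₀ x - (u₀ ((k:ℝ) / N) + s * (u₀ (((k + 1 : ℕ):ℝ) / N) - u₀ ((k:ℝ) / N)))
      = (1 - s) * A - s * B := by simp only [A, B]; ring
    rw [e1]
    have e2 : ((1 - s) * A - s * B) ^ 2 = (1 - s) * A ^ 2 + s * B ^ 2 - s * (1 - s) * (A + B) ^ 2 := by
      ring
    have e3 : 0 ≤ s * (1 - s) * (A + B) ^ 2 :=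
      mul_nonneg (mul_nonneg s0 (by linarith)) (sq_nonneg _)
    have e4 := mul_le_mul_of_nonneg_left h1 (show 0 ≤ 1 - s by linarith)
    have e5 := mul_le_mul_of_nonneg_left h2 s0
    rw [e2]; linarith
  have hl : ∀ k, ∫ x in ((k:ℝ) / N)..(((k + 1 : ℕ) : ℝ) / N), L e k x ^ 2
      ≥ 1 / (12 * N) * (e ((k : ZMod N) + 1) - e (k : ZMod N)) ^ 2 := by
    intro k
    simp only [hL]
    set A := e (k : ZMod N)
    set δ := e ((k : ZMod N) + 1) - A
    have hF : ∀ x ∈ uIcc ((k:ℝ) / N) (((k + 1 : ℕ) : ℝ) / N), HasDerivAt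
        (fun x => A ^ 2 * x + A * δ * (x * N - k) ^ 2 / N + δ ^ 2 * (x * N - k) ^ 3 / (3 * N))
        ((A + (x * N - k) * δ) ^ 2) x := by
      intro x _
      have hb : HasDerivAt (fun x : ℝ => x * N - k) N x := by
        simpa using ((hasDerivAt_id x).mul_const (N:ℝ)).sub_const (k:ℝ)
      have := (((hasDerivAt_id x).const_mul (A ^ 2)).add
        (((hb.pow 2).const_mul (A * δ)).div_const (N:ℝ))).add
        (((hb.pow 3).const_mul (δ ^ 2)).div_const (3 * N:ℝ))
      refine this.congr_deriv ?_
      simp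
      field_simp
      ring
    rw [intervalIntegral.integral_eq_sub_of_hasDerivAt hF
      (Continuous.intervalIntegrable (by fun_prop) _ _)]
    have e1 : ((k + 1 : ℕ) : ℝ) / N * N - k = 1 := by
      rw [div_mul_cancel₀ _ hN'.ne']; push_cast; ring
    have e2 : (k : ℝ) / N * N - k = 0 := by
      rw [div_mul_cancel₀ _ hN'.ne']; ring
    rw [e1, e2]
    have e3 : A ^ 2 * (((k + 1 : ℕ) : ℝ) / N) + A * δ * 1 ^ 2 / N + δ ^ 2 * 1 ^ 3 / (3 * N) -
      (A ^ 2 * ((k : ℝ) / N) + A * δ * 0 ^ 2 / N + δ ^ 2 * 0 ^ 3 / (3 * N))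
      = 1 / (12 * N) * δ ^ 2 + (A + δ / 2) ^ 2 / N := by
      push_cast; field_simp; ring
    rw [e3]
    have : 0 ≤ (A + δ / 2) ^ 2 / N := by positivity
    linarith
  have hk : ∀ k ∈ Finset.range N,
      ∫ x in ((k:ℝ) / N)..(((k + 1 : ℕ) : ℝ) / N), (u₀ x - L w k x) * L e k x
      ≤ 1 / 2 * (1 / N * (1 / N * J k))
        - 1 / 2 * (1 / (12 * N) * (e ((k : ZMod N) + 1) - e (k : ZMod N)) ^ 2) := by
    intro k hk
    have hk' := Finset.mem_range.1 hk
    have c1 := hLc e k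
    have c2 := hLc w k
    calc _ ≤ ∫ x in ((k:ℝ) / N)..(((k + 1 : ℕ) : ℝ) / N),
            (1 / 2 * (1 / N * J k) - 1 / 2 * L e k x ^ 2) := by
          apply intervalIntegral.integral_mono_on (hle k)
          · exact Continuous.intervalIntegrable (by fun_prop) _ _
          · exact Continuous.intervalIntegrable (by fun_prop) _ _
          · intro x hx
            have := hr k hk' x hx
            have e1 : u₀ x - L w k x = (u₀ x - L v k x) - L e k x := by
              simp only [hL, he]; ring
            rw [e1]
            nlinarith [sq_nonneg (u₀ x - L v k x - L e k x)]
      _ = 1 / N * (1 / 2 * (1 / N * J k)) - 1 / 2 *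
            ∫ x in ((k:ℝ) / N)..(((k + 1 : ℕ) : ℝ) / N), L e k x ^ 2 := by
          rw [intervalIntegral.integral_sub, intervalIntegral.integral_const,
            intervalIntegral.integral_const_mul, smul_eq_mul, hwid]
          all_goals exact Continuous.intervalIntegrable (by fun_prop) _ _
      _ ≤ _ := by have := hl k; linarith
  have hs := Finset.sum_le_sum hk
  rw [horth, Finset.sum_sub_distrib] at hs
  simp only [← Finset.mul_sum] at hs
  have hint : ∑ k ∈ Finset.range N, (v ((k : ZMod N) + 1) - v (k : ZMod N)) ^ 2
      ≤ 1 / N * ∑ k ∈ Finset.range N, J k := by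
    rw [Finset.mul_sum]
    refine Finset.sum_le_sum fun k hk => ?_
    have hk' := Finset.mem_range.1 hk
    rw [hv1 k hk', hv2 k hk', ← hwid k]
    exact cs_elem hu (le_refl _) (hle k) (le_refl _)
  rw [sum_zmod, hEint]
  set SJ := ∑ k ∈ Finset.range N, J k
  have hsplit : ∑ k ∈ Finset.range N, (w ((k : ZMod N) + 1) - w (k : ZMod N)) ^ 2
      ≤ 2 * ∑ k ∈ Finset.range N, (e ((k : ZMod N) + 1) - e (k : ZMod N)) ^ 2
        + 2 * ∑ k ∈ Finset.range N, (v ((k : ZMod N) + 1) - v (k : ZMod N)) ^ 2 := by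
    rw [Finset.mul_sum, Finset.mul_sum, ← Finset.sum_add_distrib]
    refine Finset.sum_le_sum fun k _ => ?_
    have : w ((k : ZMod N) + 1) - w (k : ZMod N) = (e ((k : ZMod N) + 1) - e (k : ZMod N))
      + (v ((k : ZMod N) + 1) - v (k : ZMod N)) := by simp only [he]; ring
    rw [this]
    nlinarith [sq_nonneg ((e ((k : ZMod N) + 1) - e (k : ZMod N))
      - (v ((k : ZMod N) + 1) - v (k : ZMod N)))]
  set SE := ∑ k ∈ Finset.range N, (e ((k : ZMod N) + 1) - e (k : ZMod N)) ^ 2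
  have hSE : SE ≤ 12 * (1 / N * SJ) := by
    have h1 : 1 / 2 * (1 / (12 * (N:ℝ)) * SE) = 1 / (24 * N) * SE := by field_simp; ring
    have h2 : 1 / 2 * (1 / (N:ℝ) * (1 / N * SJ)) = 1 / (24 * N) * (12 * (1 / N * SJ)) := by
      field_simp; ring
    rw [h1, h2] at hs
    exact le_of_mul_le_mul_left (by linarith) (show 0 < 1 / (24 * (N:ℝ)) by positivity)
  have : 26 / (N:ℝ) * SJ = 26 * (1 / N * SJ) := by ring
  rw [this]; linarith

lemma energy_case1 {U a b h x y z : ℝ} (ha : 0 ≤ a) (hb : 0 ≤ b) (hab : a + b = U)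
    (hz : h * z = a * x + b * y) : (h * z) ^ 2 ≤ U ^ 2 * (x ^ 2 + y ^ 2) := by
  rw [hz, ← hab]
  nlinarith [sq_nonneg (a * y - b * x), mul_nonneg ha hb, sq_nonneg x, sq_nonneg y,
    mul_nonneg (mul_nonneg ha hb) (sq_nonneg x), mul_nonneg (mul_nonneg ha hb) (sq_nonneg y)]

lemma stab_core {N : ℕ} [NeZero N] {T h U κ ν E : ℝ} (hT : 0 < T) (hh : h = 1 / N) (hU : 0 ≤ U)
    (hν : 0 ≤ ν) (hκ : κ = max (U / 2) (ν / h)) (hE : 0 ≤ E)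
    {u u' : ℝ → ZMod N → ℝ}
    (hd : ∀ i, ∀ t ∈ Icc (0 : ℝ) T,
        HasDerivWithinAt (fun s => u s i) (u' t i) (Icc (0 : ℝ) T) t)
    (hs : ∀ i, ∀ t ∈ Icc (0 : ℝ) T,
        h * u' t i = (κ - (u t (i-1) + u t i + u t (i+1)) / 6) * (u t (i+1) - u t i)
          + (κ + (u t (i-1) + u t i + u t (i+1)) / 6) * (u t (i-1) - u t i))
    (h0 : ∀ i, |u 0 i| ≤ U)
    (hp : ∑ i, (u 0 (i+1) - u 0 i) ^ 2 ≤ 26 / N * E) :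
    (∫ t in (0 : ℝ)..T, (h / 3) * ∑ i : ZMod N,
            (u' t i ^ 2 + u' t i * u' t (i + 1) + u' t (i + 1) ^ 2))
      ≤ 52 * U ^ 2 * E / h * T + 26 * ν * E := by
  have hN : (0:ℝ) < N := by exact_mod_cast Nat.pos_of_ne_zero (NeZero.ne N)
  have hh0 : 0 < h := by rw [hh]; positivity
  have hκU : U / 2 ≤ κ := by rw [hκ]; exact le_max_left _ _
  have hb := max_principle hh0 hU hκU hd hs h0
  have htv := tvd hh0 hκU hd hs hb
  have hTV0 : (∑ i, |u 0 (i+1) - u 0 i|) ^ 2 ≤ 26 * E := by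
    have := sq_sum_le_card_mul_sum_sq (s := (Finset.univ : Finset (ZMod N)))
      (f := fun i => |u 0 (i+1) - u 0 i|)
    simp only [sq_abs, Finset.card_univ, ZMod.card] at this
    refine this.trans ((mul_le_mul_of_nonneg_left hp hN.le).trans (le_of_eq ?_))
    field_simp
  have hD : ∀ t ∈ Icc (0:ℝ) T, ∑ i, (u t (i+1) - u t i) ^ 2 ≤ 26 * E := by
    intro t ht
    refine le_trans ?_ hTV0
    have h1 : ∑ i, (u t (i+1) - u t i) ^ 2 ≤ (∑ i, |u t (i+1) - u t i|) ^ 2 := by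
      have := Finset.sum_sq_le_sq_sum_of_nonneg (s := (Finset.univ : Finset (ZMod N)))
        (f := fun i => |u t (i+1) - u t i|) (fun i _ => abs_nonneg _)
      simpa only [sq_abs] using this
    exact h1.trans (pow_le_pow_left₀ (Finset.sum_nonneg fun i _ => abs_nonneg _) (htv t ht) 2)
  -- derivative of the H1 seminorm
  have hV : ∀ t ∈ Icc (0:ℝ) T, HasDerivWithinAt (fun s => ∑ i, (u s (i+1) - u s i) ^ 2)
      (∑ i, 2 * (u t (i+1) - u t i) * (u' t (i+1) - u' t i)) (Icc 0 T) t := by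
    intro t ht
    apply HasDerivWithinAt.fun_sum
    intro i _
    refine (((hd (i+1) t ht).sub (hd i t ht)).pow 2).congr_deriv ?_
    simp
  have hV2 : ∀ t, (∑ i, 2 * (u t (i+1) - u t i) * (u' t (i+1) - u' t i))
      = - 2 * ∑ i, u' t i * ((u t (i+1) - u t i) + (u t (i-1) - u t i)) := by
    intro t
    have q := sum_shift (fun i => u' t i * (u t i - u t (i-1)))
    simp only [add_sub_cancel_right] at q
    calc _ = 2 * (∑ i, u' t (i+1) * (u t (i+1) - u t i)) - 2 * ∑ i, u' t i * (u t (i+1) - u t i) := by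
          rw [Finset.mul_sum, Finset.mul_sum, ← Finset.sum_sub_distrib]
          exact Finset.sum_congr rfl fun i _ => by ring
      _ = _ := by
          rw [q, Finset.mul_sum, Finset.mul_sum, Finset.mul_sum, ← Finset.sum_sub_distrib]
          exact Finset.sum_congr rfl fun i _ => by ring
  have hshiftD : ∀ t, ∑ i, (u t (i-1) - u t i) ^ 2 = ∑ i, (u t (i+1) - u t i) ^ 2 := by
    intro t
    rw [← sum_shift (fun i => (u t (i-1) - u t i) ^ 2)]
    refine Finset.sum_congr rfl fun i _ => ?_
    rw [add_sub_cancel_right]; ring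
  -- pointwise energy bound
  have hpt : ∃ ν' : ℝ, 0 ≤ ν' ∧ ν' ≤ ν ∧ ∀ t ∈ Icc (0:ℝ) T, h * ∑ i, u' t i ^ 2
      ≤ 52 * U ^ 2 * E / h
        - ν' / h * (∑ i, 2 * (u t (i+1) - u t i) * (u' t (i+1) - u' t i)) := by
    rcases le_total (ν / h) (U / 2) with hc | hc
    · refine ⟨0, le_refl _, hν, fun t ht => ?_⟩
      have hκ' : κ = U / 2 := by rw [hκ, max_eq_left hc]
      have key : ∀ i, (h * u' t i) ^ 2
          ≤ U ^ 2 * ((u t (i+1) - u t i) ^ 2 + (u t (i-1) - u t i) ^ 2) := by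
        intro i
        have e1 := abs_le.1 (hb t ht (i-1))
        have e2 := abs_le.1 (hb t ht i)
        have e3 := abs_le.1 (hb t ht (i+1))
        exact energy_case1 (by linarith) (by linarith) (by linarith) (hs i t ht)
      have hsum := Finset.sum_le_sum fun i (_ : i ∈ (Finset.univ : Finset (ZMod N))) => key i
      rw [← Finset.mul_sum, Finset.sum_add_distrib, hshiftD] at hsum
      simp only [mul_pow] at hsum
      rw [← Finset.mul_sum] at hsum
      have h2 : U ^ 2 * (∑ i, (u t (i+1) - u t i) ^ 2 + ∑ i, (u t (i+1) - u t i) ^ 2)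
          ≤ U ^ 2 * (52 * E) := mul_le_mul_of_nonneg_left (by linarith [hD t ht]) (sq_nonneg _)
      rw [zero_div, zero_mul, sub_zero, le_div_iff₀ hh0]
      nlinarith
    · refine ⟨ν, hν, le_refl _, fun t ht => ?_⟩
      have hκ' : κ = ν / h := by rw [hκ, max_eq_right hc]
      have key : ∀ i, h * u' t i ^ 2 ≤
          U ^ 2 / h * ((u t (i+1) - u t i) ^ 2 + (u t (i-1) - u t i) ^ 2)
          + 2 * (ν / h) * (u' t i * ((u t (i+1) - u t i) + (u t (i-1) - u t i))) := by
        intro i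
        have e1 := abs_le.1 (hb t ht (i-1))
        have e2 := abs_le.1 (hb t ht i)
        have e3 := abs_le.1 (hb t ht (i+1))
        have hs' := hs i t ht
        rw [hκ'] at hs'
        set s := (u t (i-1) + u t i + u t (i+1)) / 6 with hsdef
        set x := u t (i+1) - u t i
        set y := u t (i-1) - u t i
        set z := u' t i
        set k := ν / h
        have hsU : s ^ 2 ≤ (U / 2) ^ 2 := by
          apply sq_le_sq'
          · linarith
          · linarith
        have hA : h * (h * z ^ 2) ≤ U ^ 2 * (x ^ 2 + y ^ 2) + h * (2 * k * (z * (x + y))) := by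
          have h1 : h * (h * z ^ 2) = 2 * ((h * z) * (-s * (x - y))) - (h * z) ^ 2 + 
              h * (2 * k * (z * (x + y))) := by
            have : h * z * (h * z) = h * z * ((k - s) * x + (k + s) * y) := by rw [hs']
            linarith
          have h2 : 2 * ((h * z) * (-s * (x - y))) - (h * z) ^ 2 ≤ s ^ 2 * (x - y) ^ 2 := by
            nlinarith [sq_nonneg (h * z + s * (x - y))]
          have h3 : s ^ 2 * (x - y) ^ 2 ≤ (U / 2) ^ 2 * (x - y) ^ 2 :=
            mul_le_mul_of_nonneg_right hsU (sq_nonneg _)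
          have h4 : (U / 2) ^ 2 * (x - y) ^ 2 ≤ (U / 2) ^ 2 * (4 * (x ^ 2 + y ^ 2)) :=
            mul_le_mul_of_nonneg_left (by nlinarith [sq_nonneg (x + y), sq_nonneg x, sq_nonneg y])
              (sq_nonneg _)
          linarith
        have hB : h * (U ^ 2 / h * (x ^ 2 + y ^ 2)) = U ^ 2 * (x ^ 2 + y ^ 2) := by
          field_simp
        refine le_of_mul_le_mul_left ?_ hh0
        rw [mul_add, hB]; exact hA
      have hsum := Finset.sum_le_sum fun i (_ : i ∈ (Finset.univ : Finset (ZMod N))) => key i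
      rw [Finset.sum_add_distrib, ← Finset.mul_sum, ← Finset.mul_sum, ← Finset.mul_sum,
        Finset.sum_add_distrib, hshiftD] at hsum
      rw [hV2]
      have h2 : U ^ 2 / h * (∑ i, (u t (i+1) - u t i) ^ 2 + ∑ i, (u t (i+1) - u t i) ^ 2)
          ≤ U ^ 2 / h * (52 * E) :=
        mul_le_mul_of_nonneg_left (by linarith [hD t ht]) (by positivity)
      have h3 : U ^ 2 / h * (52 * E) = 52 * U ^ 2 * E / h := by ring
      linarith
  obtain ⟨ν', hν'0, hν'ν, hpt⟩ := hpt
  -- continuity of u' on [0,T]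
  have huc : ∀ i, ContinuousOn (fun t => u t i) (Icc 0 T) := fun i t ht =>
    (hd i t ht).continuousWithinAt
  have hu'c : ∀ i, ContinuousOn (fun t => u' t i) (Icc 0 T) := by
    intro i
    have c1 := huc (i-1)
    have c2 := huc i
    have c3 := huc (i+1)
    have : ContinuousOn (fun t => ((κ - (u t (i-1) + u t i + u t (i+1)) / 6) * (u t (i+1) - u t i)
          + (κ + (u t (i-1) + u t i + u t (i+1)) / 6) * (u t (i-1) - u t i)) / h) (Icc 0 T) := by
      fun_prop
    refine this.congr fun t ht => ?_
    simp only
    rw [← hs i t ht, mul_div_cancel_left₀ _ hh0.ne']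
  have hG1 : ContinuousOn (fun t => (h / 3) * ∑ i : ZMod N,
            (u' t i ^ 2 + u' t i * u' t (i + 1) + u' t (i + 1) ^ 2)) (Icc 0 T) := by
    refine continuousOn_const.mul (continuousOn_finsetSum _ fun i _ => ?_)
    have c2 := hu'c i
    have c3 := hu'c (i+1)
    fun_prop
  have hG2 : ContinuousOn (fun t => 52 * U ^ 2 * E / h
        - ν' / h * (∑ i, 2 * (u t (i+1) - u t i) * (u' t (i+1) - u' t i))) (Icc 0 T) := by
    refine continuousOn_const.sub (continuousOn_const.mul (continuousOn_finsetSum _ fun i _ => ?_))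
    have c0 := huc i
    have c1 := huc (i+1)
    have c2 := hu'c i
    have c3 := hu'c (i+1)
    fun_prop
  have hF : ∀ t ∈ Icc (0:ℝ) T, HasDerivWithinAt
      (fun t => 52 * U ^ 2 * E / h * t - ν' / h * ∑ i, (u t (i+1) - u t i) ^ 2)
      (52 * U ^ 2 * E / h
        - ν' / h * (∑ i, 2 * (u t (i+1) - u t i) * (u' t (i+1) - u' t i))) (Icc 0 T) t := by
    intro t ht
    exact ((((hasDerivAt_id t).const_mul (52 * U ^ 2 * E / h)).hasDerivWithinAt).sub
      ((hV t ht).const_mul (ν' / h))).congr_deriv (by simp)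
  have hint := intervalIntegral.integral_eq_sub_of_hasDerivAt_of_le hT.le
    (fun t ht => (hF t ht).continuousWithinAt)
    (fun t ht => (hF t (Ioo_subset_Icc_self ht)).hasDerivAt (Icc_mem_nhds ht.1 ht.2))
    (hG2.intervalIntegrable_of_Icc hT.le)
  have hmono : (∫ t in (0 : ℝ)..T, (h / 3) * ∑ i : ZMod N,
            (u' t i ^ 2 + u' t i * u' t (i + 1) + u' t (i + 1) ^ 2))
      ≤ ∫ t in (0:ℝ)..T, (52 * U ^ 2 * E / h
        - ν' / h * (∑ i, 2 * (u t (i+1) - u t i) * (u' t (i+1) - u' t i))) := by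
    apply intervalIntegral.integral_mono_on hT.le (hG1.intervalIntegrable_of_Icc hT.le)
      (hG2.intervalIntegrable_of_Icc hT.le)
    intro t ht
    refine le_trans ?_ (hpt t ht)
    have h1 : ∑ i : ZMod N, (u' t i ^ 2 + u' t i * u' t (i + 1) + u' t (i + 1) ^ 2)
        ≤ ∑ i : ZMod N, (3 / 2 * u' t i ^ 2 + 3 / 2 * u' t (i+1) ^ 2) :=
      Finset.sum_le_sum fun i _ => by nlinarith [sq_nonneg (u' t i - u' t (i+1))]
    have h2 : ∑ i : ZMod N, (3 / 2 * u' t i ^ 2 + 3 / 2 * u' t (i+1) ^ 2)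
        = 3 * ∑ i, u' t i ^ 2 := by
      rw [Finset.sum_add_distrib, ← Finset.mul_sum, ← Finset.mul_sum,
        sum_shift (fun i => u' t i ^ 2)]
      ring
    rw [h2] at h1
    have := mul_le_mul_of_nonneg_left h1 (show 0 ≤ h / 3 by positivity)
    linarith
  rw [hint] at hmono
  have h5 : 0 ≤ ν' / h * ∑ i, (u T (i+1) - u T i) ^ 2 :=
    mul_nonneg (by positivity) (Finset.sum_nonneg fun i _ => sq_nonneg _)
  have h6 : ν' / h * ∑ i, (u 0 (i+1) - u 0 i) ^ 2 ≤ 26 * ν * E := by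
    calc _ ≤ ν' / h * (26 / N * E) := mul_le_mul_of_nonneg_left hp (by positivity)
      _ = 26 * ν' * E := by rw [hh]; field_simp
      _ ≤ _ := by gcongr
  linarith

/-- **Stability of the discrete time derivative for the mass-lumped Galerkin
scheme with linear artificial viscosity:**  there is a constant `C`, independent
of `N`, `h`, `ν`, `T` and the data, such that if the initial nodal values are
the `L²`-projection of a continuously differentiable 1-periodic `u₀`, then
`‖∂ₜ u_h‖_{L²(Q)} ≤ C (U₀ T^{1/2} h^{−1/2} + ν^{1/2}) ‖u₀'‖_{L²(0,1)}`. -/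
theorem discrete_time_derivative_stability :
    ∃ C : ℝ, 0 < C ∧
      ∀ (N : ℕ) [NeZero N], 3 ≤ N →
      ∀ T ν : ℝ, 0 < T → 0 ≤ ν →
      ∀ u₀ : ℝ → ℝ, ContDiff ℝ 1 u₀ → (∀ x, u₀ (x + 1) = u₀ x) →
      ∀ u u' : ℝ → ZMod N → ℝ, ∀ h : ℝ, h = 1 / N →
      ∀ d : ℝ → ZMod N → ℝ, (∀ t i, d t i = (u t (i + 1) - u t i) / h) →
      ∀ U₀ : ℝ,
        U₀ = (Finset.univ.sup' ⟨(0 : ZMod N), Finset.mem_univ _⟩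
          fun j => |u 0 j|) →
      ∀ νhat : ℝ, νhat = max (U₀ * h / 2) ν →
      -- the scheme
      (∀ i, ∀ t ∈ Icc (0 : ℝ) T,
        HasDerivWithinAt (fun s => u s i) (u' t i) (Icc (0 : ℝ) T) t) →
      (∀ i, ∀ t ∈ Icc (0 : ℝ) T,
        h * u' t i
          = -(1 / 6) * (u t (i + 1) ^ 2 + u t i * u t (i + 1)
              - u t i * u t (i - 1) - u t (i - 1) ^ 2)
            + νhat * d t i - νhat * d t (i - 1)) →
      -- initial data : u_h(·,0) = π_h u₀  (L²-orthogonality of the residual)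
      (∀ v : ZMod N → ℝ,
        (∫ x in (0 : ℝ)..1, (u₀ x - plin N (u 0) x) * plin N v x) = 0) →
      -- stability of the discrete time derivative
      Real.sqrt (∫ t in (0 : ℝ)..T, (h / 3) * ∑ i : ZMod N,
            (u' t i ^ 2 + u' t i * u' t (i + 1) + u' t (i + 1) ^ 2))
        ≤ C * (U₀ * Real.sqrt T / Real.sqrt h + Real.sqrt ν)
            * Real.sqrt (∫ x in (0 : ℝ)..1, deriv u₀ x ^ 2) := by
  refine ⟨8, by norm_num, ?_⟩
  intro N _ hN T ν hT hν u₀ hu hper u u' h hh d hd U₀ hU₀ νhat hνhat hder hsch hproj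
  have hN' : (0:ℝ) < N := by exact_mod_cast (by omega : 0 < N)
  have hh0 : 0 < h := by rw [hh]; positivity
  have h0 : ∀ i, |u 0 i| ≤ U₀ := fun i => by
    rw [hU₀]; exact Finset.le_sup' (fun j => |u 0 j|) (Finset.mem_univ i)
  have hU : 0 ≤ U₀ := (abs_nonneg _).trans (h0 0)
  set E := ∫ x in (0 : ℝ)..1, deriv u₀ x ^ 2 with hE
  have hE0 : 0 ≤ E := intervalIntegral.integral_nonneg zero_le_one fun _ _ => sq_nonneg _
  have hp := proj_stab hu hper (u 0) hproj
  have hκ : νhat / h = max (U₀ / 2) (ν / h) := by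
    rw [hνhat, ← max_div_div_right hh0.le]
    congr 1
    field_simp
  have hcore := stab_core hT hh hU hν hκ hE0 hder (fun i t ht => by
    rw [hsch i t ht, hd, hd, sub_add_cancel]; ring) h0 hp
  refine (Real.sqrt_le_sqrt hcore).trans ?_
  apply Real.sqrt_le_iff.2 ⟨by positivity, ?_⟩
  have s1 : (U₀ * Real.sqrt T / Real.sqrt h) ^ 2 = U₀ ^ 2 * T / h := by
    rw [div_pow, mul_pow, Real.sq_sqrt hT.le, Real.sq_sqrt hh0.le]
  have s2 := Real.sq_sqrt hν
  have s3 := Real.sq_sqrt hE0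
  have s4 : 0 ≤ U₀ * Real.sqrt T / Real.sqrt h := by positivity
  have s5 := Real.sqrt_nonneg ν
  set A := U₀ * Real.sqrt T / Real.sqrt h
  set B := Real.sqrt ν
  have e1 : 52 * U₀ ^ 2 * E / h * T = 52 * A ^ 2 * E := by rw [s1]; ring
  rw [e1, mul_pow, mul_pow, s3, ← s2]
  have : 52 * A ^ 2 + 26 * B ^ 2 ≤ 8 ^ 2 * (A + B) ^ 2 := by nlinarith [mul_nonneg s4 s5, sq_nonneg A, sq_nonneg B]
  nlinarith [mul_le_mul_of_nonneg_right this hE0]
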